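/- Let d ≥ 1, T ≥ 1, C0, C1 > 0, γ > 0, λ > 0 with γλ ∈ (1/2, 1), δ ∈ (0,1), and ε ∈ (0, 3 log(1/δ)). Let G : ℝ^d → ℝ^d be measurable and let x_0, x_0' ∈ ℝ^d be deterministic with ‖x_0‖ ≤ C0 and ‖x_0'‖ ≤ C0. Define x_{t+1} = x_t − γ (Π_{C1}(G(x_t)) + λ x_t) + ξ_t and x_{t+1}' = x_t' − γ (Π_{C1}(G(x_t')) + λ x_t') + ξ_t', with ξ_t, ξ_t' independent N(0, σ² I_d), where σ² = (72 γλ log(1/δ) / ε²) ( C0 (1 − γλ)^T + C1/λ )². Then the laws P, P' of x_T and x_T' satisfy both E_ε(P ‖ P') ≤ δ and E_ε(P' ‖ P) ≤ δ; i.e., the regularized gradient-clipping unlearning algorithm satisfies (ε, δ)-unlearning. -/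

import Mathlib

open MeasureTheory Real Finset ENNReal

noncomputable section

abbrev E (d : ℕ) := EuclideanSpace ℝ (Fin d)

/-- Norm clipping operator `Π_C(x) = x ⬝ min(C/‖x‖, 1)`. -/
def clip {d : ℕ} (C : ℝ) (x : E d) : E d := (min (C / ‖x‖) 1) • x

/-- Gaussian measure `N(m, v I_d)` on `ℝ^d` (with variance `v`), via its density. -/
def gaussian (d : ℕ) (m : E d) (v : ℝ) : Measure (E d) :=
  volume.withDensity fun x =>
    ENNReal.ofReal ((2 * Real.pi * v) ^ (-(d : ℝ) / 2) * Real.exp (-‖x - m‖ ^ 2 / (2 * v)))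

/-- Rényi divergence of order `q`. -/
def renyiDiv {d : ℕ} (q : ℝ) (μ ν : Measure (E d)) : ℝ :=
  (q - 1)⁻¹ * Real.log (∫ x, ((μ.rnDeriv ν x).toReal) ^ q ∂ν)

/-- Hockey-stick divergence `E_ε(μ‖ν) = sup_A (μ(A) − e^ε ν(A))`. -/
def hockeyStick {d : ℕ} (ε : ℝ) (μ ν : Measure (E d)) : ℝ :=
  ⨆ A : {s : Set (E d) // MeasurableSet s},
    ((μ A.1).toReal - Real.exp ε * (ν A.1).toReal)

/-- `∞`-Wasserstein distance. -/
def wInfty {d : ℕ} (μ ν : Measure (E d)) : ℝ≥0∞ :=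
  ⨅ (ω : Measure (E d × E d)) (_ : ω.map Prod.fst = μ) (_ : ω.map Prod.snd = ν),
    essSup (fun p => edist p.1 p.2) ω

/-- Shifted Rényi divergence `D_q^{(z)}(μ‖ν)`. -/
def shiftedRenyi {d : ℕ} (q z : ℝ) (μ ν : Measure (E d)) : ℝ :=
  sInf ((fun μ' => renyiDiv q μ' ν) ''
    {μ' : Measure (E d) | IsProbabilityMeasure μ' ∧ wInfty μ' μ ≤ ENNReal.ofReal z})

/-- Law of the iterates `x_{t+1} = ψ_t(x_t) + ξ_t`, `ξ_t ~ N(0, v_t I_d)`, with `x_0 ~ μ0`. -/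
def lawSeq {d : ℕ} (ψ : ℕ → E d → E d) (v : ℕ → ℝ) (μ0 : Measure (E d)) : ℕ → Measure (E d)
  | 0 => μ0
  | t + 1 => (lawSeq ψ v μ0 t).bind fun x => gaussian d (ψ t x) (v t)

/-- Standard Gaussian tail function `Q`. -/
def gaussQ (t : ℝ) : ℝ := (Real.sqrt (2 * Real.pi))⁻¹ * ∫ u in Set.Ioi t, Real.exp (-u ^ 2 / 2)

/-- Amplification factor `θ_ε(r) = Q(ε/r − r/2) − e^ε Q(ε/r + r/2)`. -/
def theta (ε r : ℝ) : ℝ := gaussQ (ε / r - r / 2) - Real.exp ε * gaussQ (ε / r + r / 2)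

theorem norm_clip_le {d : ℕ} {C : ℝ} (hC : 0 ≤ C) (x : E d) : ‖clip C x‖ ≤ C := by
  unfold clip
  rw [norm_smul, Real.norm_of_nonneg (le_min (by positivity) zero_le_one)]
  rcases eq_or_ne x 0 with rfl | hx
  · simpa using hC
  · calc min (C / ‖x‖) 1 * ‖x‖ ≤ C / ‖x‖ * ‖x‖ := by gcongr; exact min_le_left _ _
      _ = C := div_mul_cancel₀ _ (norm_ne_zero_iff.2 hx)

theorem measurable_clip {d : ℕ} (C : ℝ) : Measurable (clip (d := d) C) :=
  ((measurable_const.div measurable_norm).min measurable_const).smul measurable_id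

/-- Density of the isotropic Gaussian measure. -/
def gaussianDensity (d : ℕ) (m : E d) (v : ℝ) (x : E d) : ℝ :=
  (2 * Real.pi * v) ^ (-(d : ℝ) / 2) * Real.exp (-‖x - m‖ ^ 2 / (2 * v))

theorem gaussianDensity_nonneg {d : ℕ} (m : E d) {v : ℝ} (hv : 0 ≤ v) (x : E d) :
    0 ≤ gaussianDensity d m v x := by
  unfold gaussianDensity
  positivity

theorem measurable_gaussianDensity (d : ℕ) (v : ℝ) :
    Measurable fun p : E d × E d => gaussianDensity d p.1 v p.2 := by
  unfold gaussianDensity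
  fun_prop

theorem lintegral_gaussian {d : ℕ} (m : E d) (v : ℝ) {f : E d → ℝ≥0∞} (hf : Measurable f) :
    ∫⁻ y, f y ∂gaussian d m v = ∫⁻ y, ENNReal.ofReal (gaussianDensity d m v y) * f y :=
  lintegral_withDensity_eq_lintegral_mul _
    ((measurable_gaussianDensity d v).comp measurable_prodMk_left).ennreal_ofReal hf

theorem lintegral_gaussian_eq_shift {d : ℕ} (m : E d) (v : ℝ) {f : E d → ℝ≥0∞}
    (hf : Measurable f) :
    ∫⁻ y, f y ∂gaussian d m v = ∫⁻ z, f (z + m) ∂gaussian d 0 v := by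
  rw [lintegral_gaussian m v hf, lintegral_gaussian 0 v (f := fun z => f (z + m))
      (hf.comp (measurable_add_const m)),
    ← lintegral_add_right_eq_self _ m]
  simp [gaussianDensity]

theorem isProbabilityMeasure_gaussian {d : ℕ} (m : E d) {v : ℝ} (hv : 0 < v) :
    IsProbabilityMeasure (gaussian d m v) := by
  constructor
  have hb : 0 < (2 * v)⁻¹ := by positivity
  have h := GaussianFourier.integral_rexp_neg_mul_sq_norm (V := E d) hb
  rw [finrank_euclideanSpace_fin] at h
  have hint : Integrable fun x : E d => Real.exp (-(2 * v)⁻¹ * ‖x‖ ^ 2) := by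
    refine Integrable.of_integral_ne_zero ?_
    rw [h]
    positivity
  have h1 := lintegral_gaussian_eq_shift (d := d) m v (f := fun _ => 1) measurable_const
  rw [lintegral_gaussian 0 v measurable_const] at h1
  simp only [lintegral_const, one_mul, mul_one] at h1
  have heq : ∀ x : E d, gaussianDensity d 0 v x =
      (2 * Real.pi * v) ^ (-(d : ℝ) / 2) * Real.exp (-(2 * v)⁻¹ * ‖x‖ ^ 2) := fun x => by
    rw [gaussianDensity, sub_zero]
    congr 2
    ring
  rw [h1, ← ofReal_integral_eq_lintegral_ofReal]
  · simp_rw [heq]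
    rw [integral_const_mul, h]
    have hp : Real.pi / (2 * v)⁻¹ = 2 * Real.pi * v := by field_simp
    rw [hp, ← Real.rpow_add (by positivity)]
    simp [neg_div]
  · exact (hint.const_mul _).congr (Filter.Eventually.of_forall fun x => (heq x).symm)
  · exact Filter.Eventually.of_forall fun x => gaussianDensity_nonneg 0 hv.le x

theorem measurable_gaussian (d : ℕ) (v : ℝ) : Measurable fun m : E d => gaussian d m v := by
  refine Measure.measurable_of_measurable_coe _ fun A hA => ?_
  have h : ∀ m, gaussian d m v A =
      ∫⁻ y, ENNReal.ofReal (gaussianDensity d m v y) * A.indicator 1 y := fun m => by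
    rw [← lintegral_gaussian m v (measurable_one.indicator hA), lintegral_indicator_one hA]
  simp_rw [h]
  exact Measurable.lintegral_prod_right' ((measurable_gaussianDensity d v).ennreal_ofReal.mul
    ((measurable_one.indicator hA).comp measurable_snd))

/-- Pointwise form of the Gaussian mechanism: outside the region where the likelihood ratio is at
most `e^ε`, the density is dominated by `δ` times a shifted Gaussian density. -/
theorem gaussianDensity_le {d : ℕ} (m m' : E d) {v ε L s : ℝ} (hv : 0 < v) (hs : 0 ≤ s)
    (hL : (s ^ 2 + s) * ‖m - m'‖ ^ 2 / (2 * v) - s * ε ≤ -L) (y : E d) :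
    gaussianDensity d m v y ≤ Real.exp ε * gaussianDensity d m' v y +
      Real.exp (-L) * gaussianDensity d (m + s • (m - m')) v y := by
  have hk : 0 ≤ (2 * Real.pi * v) ^ (-(d : ℝ) / 2) := by positivity
  set u := m - m' with hu
  set w := y - m with hw
  have h1 : ‖y - m'‖ ^ 2 = ‖w‖ ^ 2 + 2 * inner ℝ w u + ‖u‖ ^ 2 := by
    rw [← norm_add_sq_real]; congr 2; simp [hu, hw]
  have h2 : ‖y - (m + s • u)‖ ^ 2 = ‖w‖ ^ 2 - 2 * s * inner ℝ w u + s ^ 2 * ‖u‖ ^ 2 := by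
    have : y - (m + s • u) = w - s • u := by rw [hw]; abel
    rw [this, norm_sub_sq_real, inner_smul_right, norm_smul, mul_pow, Real.norm_eq_abs, sq_abs]
    ring
  have e1 := gaussianDensity_nonneg m' hv.le y
  have e2 := gaussianDensity_nonneg (m + s • u) hv.le y
  rcases le_total (2 * inner ℝ w u + ‖u‖ ^ 2) (2 * v * ε) with h | h
  · have : gaussianDensity d m v y ≤ Real.exp ε * gaussianDensity d m' v y := by
      unfold gaussianDensity
      rw [mul_left_comm, ← Real.exp_add]
      gcongr
      rw [h1, ← sub_nonneg]
      have : ε + -(‖w‖ ^ 2 + 2 * inner ℝ w u + ‖u‖ ^ 2) / (2 * v) - -‖w‖ ^ 2 / (2 * v) =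
        (2 * v * ε - (2 * inner ℝ w u + ‖u‖ ^ 2)) / (2 * v) := by field_simp; ring
      rw [this]
      exact div_nonneg (by linarith) (by positivity)
    linarith [mul_nonneg (Real.exp_nonneg (-L)) e2]
  · have : gaussianDensity d m v y ≤ Real.exp (-L) * gaussianDensity d (m + s • u) v y := by
      unfold gaussianDensity
      rw [mul_left_comm, ← Real.exp_add]
      gcongr
      rw [h2]
      refine le_trans ?_ (add_le_add_left hL _)
      rw [← sub_nonneg]
      have : (s ^ 2 + s) * ‖u‖ ^ 2 / (2 * v) - s * ε +
          -(‖w‖ ^ 2 - 2 * s * inner ℝ w u + s ^ 2 * ‖u‖ ^ 2) / (2 * v) - -‖w‖ ^ 2 / (2 * v) =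
        s * (2 * inner ℝ w u + ‖u‖ ^ 2 - 2 * v * ε) / (2 * v) := by field_simp; ring
      rw [this]
      exact div_nonneg (mul_nonneg hs (by linarith)) (by positivity)
    linarith [mul_nonneg (Real.exp_nonneg ε) e1]

theorem gaussian_apply_le {d : ℕ} (m m' : E d) {v ε L s : ℝ} (hv : 0 < v) (hs : 0 ≤ s)
    (hL : (s ^ 2 + s) * ‖m - m'‖ ^ 2 / (2 * v) - s * ε ≤ -L) {A : Set (E d)}
    (hA : MeasurableSet A) :
    gaussian d m v A ≤ ENNReal.ofReal (Real.exp ε) * gaussian d m' v A +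
      ENNReal.ofReal (Real.exp (-L)) := by
  have hmeas : ∀ m : E d, Measurable fun y => ENNReal.ofReal (gaussianDensity d m v y) :=
    fun m => ((measurable_gaussianDensity d v).comp measurable_prodMk_left).ennreal_ofReal
  have happ : ∀ m : E d, gaussian d m v A = ∫⁻ y in A, ENNReal.ofReal (gaussianDensity d m v y) :=
    fun m => withDensity_apply _ hA
  have := isProbabilityMeasure_gaussian (m + s • (m - m')) hv
  calc gaussian d m v A
      ≤ ∫⁻ y in A, (ENNReal.ofReal (Real.exp ε) * ENNReal.ofReal (gaussianDensity d m' v y) +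
        ENNReal.ofReal (Real.exp (-L)) *
          ENNReal.ofReal (gaussianDensity d (m + s • (m - m')) v y)) := by
        rw [happ]
        refine lintegral_mono fun y => ?_
        have e1 := gaussianDensity_nonneg m' hv.le y
        have e2 := gaussianDensity_nonneg (m + s • (m - m')) hv.le y
        rw [← ENNReal.ofReal_mul (by positivity), ← ENNReal.ofReal_mul (by positivity),
          ← ENNReal.ofReal_add (by positivity) (by positivity)]
        exact ENNReal.ofReal_le_ofReal (gaussianDensity_le m m' hv hs hL y)
    _ = ENNReal.ofReal (Real.exp ε) * gaussian d m' v A +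
        ENNReal.ofReal (Real.exp (-L)) * gaussian d (m + s • (m - m')) v A := by
        rw [lintegral_add_left ((hmeas _).const_mul _), lintegral_const_mul _ (hmeas _),
          lintegral_const_mul _ (hmeas _), happ, happ]
    _ ≤ _ := by
        gcongr
        exact mul_le_of_le_one_right' prob_le_one

theorem isProbabilityMeasure_lawSeq {d : ℕ} {ψ : ℕ → E d → E d} (hψ : ∀ t, Measurable (ψ t))
    {v : ℕ → ℝ} (hv : ∀ t, 0 < v t) (μ : Measure (E d)) [IsProbabilityMeasure μ] (t : ℕ) :
    IsProbabilityMeasure (lawSeq ψ v μ t) := by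
  induction t with
  | zero => assumption
  | succ t ih =>
    exact isProbabilityMeasure_bind ((measurable_gaussian d (v t)).comp (hψ t)).aemeasurable
      (Filter.Eventually.of_forall fun x => isProbabilityMeasure_gaussian _ (hv t))

/-- If `ψ t` maps points at distance at most `D t` to points at distance at most `D (t + 1)`, then
an approximate comparison of the values of `f` at points at distance at most `D t` passes to the
laws of the `t`-th iterates, by running both chains with the same noise. -/
theorem lintegral_lawSeq_dirac_le {d : ℕ} {ψ : ℕ → E d → E d} (hψ : ∀ t, Measurable (ψ t))
    {v : ℕ → ℝ} (hv : ∀ t, 0 < v t) {D : ℕ → ℝ}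
    (hD : ∀ t x x', ‖x - x'‖ ≤ D t → ‖ψ t x - ψ t x'‖ ≤ D (t + 1)) {x₀ x₀' : E d}
    (h₀ : ‖x₀ - x₀'‖ ≤ D 0) {c η : ℝ≥0∞} (t : ℕ) {f : E d → ℝ≥0∞} (hf : Measurable f)
    (hfD : ∀ x x', ‖x - x'‖ ≤ D t → f x ≤ c * f x' + η) :
    ∫⁻ x, f x ∂lawSeq ψ v (Measure.dirac x₀) t ≤
      c * ∫⁻ x, f x ∂lawSeq ψ v (Measure.dirac x₀') t + η := by
  induction t generalizing f with
  | zero =>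
    simp only [lawSeq]
    rw [lintegral_dirac' _ hf, lintegral_dirac' _ hf]
    exact hfD _ _ h₀
  | succ t ih =>
    have hK : Measurable fun x => gaussian d (ψ t x) (v t) :=
      (measurable_gaussian d (v t)).comp (hψ t)
    simp only [lawSeq]
    rw [Measure.lintegral_bind hK.aemeasurable hf.aemeasurable,
      Measure.lintegral_bind hK.aemeasurable hf.aemeasurable]
    refine ih ((Measure.measurable_lintegral hf).comp hK) fun x x' hx => ?_
    have := isProbabilityMeasure_gaussian (0 : E d) (hv t)
    have hfs : ∀ m : E d, Measurable fun z => f (z + m) :=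
      fun m => hf.comp (measurable_add_const m)
    rw [lintegral_gaussian_eq_shift (ψ t x) _ hf, lintegral_gaussian_eq_shift (ψ t x') _ hf]
    calc ∫⁻ z, f (z + ψ t x) ∂gaussian d 0 (v t)
        ≤ ∫⁻ z, (c * f (z + ψ t x') + η) ∂gaussian d 0 (v t) :=
          lintegral_mono fun z => hfD _ _ (by simpa using hD t x x' hx)
      _ = _ := by
          rw [lintegral_add_right _ measurable_const, lintegral_const_mul _ (hfs _),
            lintegral_const, measure_univ, mul_one]

/-- Hockey-stick bound for the laws of two noisy chains, with the Gaussian mechanism applied to the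
last step only. -/
theorem hockeyStick_lawSeq_le {d : ℕ} {ψ : ℕ → E d → E d} (hψ : ∀ t, Measurable (ψ t))
    {v : ℕ → ℝ} (hv : ∀ t, 0 < v t) {D : ℕ → ℝ}
    (hD : ∀ t x x', ‖x - x'‖ ≤ D t → ‖ψ t x - ψ t x'‖ ≤ D (t + 1)) {x₀ x₀' : E d}
    (h₀ : ‖x₀ - x₀'‖ ≤ D 0) {ε L s : ℝ} (hs : 0 ≤ s) (t : ℕ)
    (hL : (s ^ 2 + s) * D (t + 1) ^ 2 / (2 * v t) - s * ε ≤ -L) :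
    hockeyStick ε (lawSeq ψ v (Measure.dirac x₀) (t + 1))
      (lawSeq ψ v (Measure.dirac x₀') (t + 1)) ≤ Real.exp (-L) := by
  have : Nonempty {s : Set (E d) // MeasurableSet s} := ⟨⟨∅, MeasurableSet.empty⟩⟩
  refine ciSup_le fun ⟨A, hA⟩ => ?_
  have hK : Measurable fun x => gaussian d (ψ t x) (v t) :=
    (measurable_gaussian d (v t)).comp (hψ t)
  have key : lawSeq ψ v (Measure.dirac x₀) (t + 1) A ≤
      ENNReal.ofReal (Real.exp ε) * lawSeq ψ v (Measure.dirac x₀') (t + 1) A +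
        ENNReal.ofReal (Real.exp (-L)) := by
    simp only [lawSeq]
    rw [Measure.bind_apply hA hK.aemeasurable, Measure.bind_apply hA hK.aemeasurable]
    refine lintegral_lawSeq_dirac_le hψ hv hD h₀ t ((Measure.measurable_coe hA).comp hK)
      fun x x' hx => gaussian_apply_le _ _ (hv t) hs (le_trans ?_ hL) hA
    have := hv t
    gcongr
    exact hD t x x' hx
  have := isProbabilityMeasure_lawSeq hψ hv (Measure.dirac x₀') (t + 1)
  have h := ENNReal.toReal_mono (by finiteness) key
  rw [ENNReal.toReal_add (by finiteness) (by finiteness), ENNReal.toReal_mul,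
    ENNReal.toReal_ofReal (by positivity), ENNReal.toReal_ofReal (by positivity)] at h
  linarith

/-- Theorem 1 (gradient clipping, with regularization): `(ε,δ)`-unlearning with
`σ² = 72 γλ log(1/δ) (C0 (1−γλ)^T + C1/λ)² / ε²`, assuming `γλ ∈ (1/2, 1)`. -/
theorem stmt5 {d : ℕ} (hd : 1 ≤ d) (T : ℕ) (hT : 1 ≤ T)
    (C0 C1 : ℝ) (hC0 : 0 < C0) (hC1 : 0 < C1) (γ : ℝ) (hγ : 0 < γ)
    (lam : ℝ) (hlam : 0 < lam) (hgl : γ * lam ∈ Set.Ioo (1 / 2 : ℝ) 1)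
    (δ : ℝ) (hδ : δ ∈ Set.Ioo (0 : ℝ) 1)
    (ε : ℝ) (hε : ε ∈ Set.Ioo (0 : ℝ) (3 * Real.log (1 / δ)))
    (σ2 : ℝ)
    (hσ2 : σ2 = 72 * (γ * lam) * Real.log (1 / δ) / ε ^ 2 *
      (C0 * (1 - γ * lam) ^ T + C1 / lam) ^ 2)
    (G : E d → E d) (hG : Measurable G)
    (x0 x0' : E d) (hx0 : ‖x0‖ ≤ C0) (hx0' : ‖x0'‖ ≤ C0) :
    hockeyStick ε
        (lawSeq (fun _ x => x - γ • (clip C1 (G x) + lam • x)) (fun _ => σ2)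
          (Measure.dirac x0) T)
        (lawSeq (fun _ x => x - γ • (clip C1 (G x) + lam • x)) (fun _ => σ2)
          (Measure.dirac x0') T) ≤ δ
      ∧
    hockeyStick ε
        (lawSeq (fun _ x => x - γ • (clip C1 (G x) + lam • x)) (fun _ => σ2)
          (Measure.dirac x0') T)
        (lawSeq (fun _ x => x - γ • (clip C1 (G x) + lam • x)) (fun _ => σ2)
          (Measure.dirac x0) T) ≤ δ := by
  obtain ⟨hgl1, hgl2⟩ := hgl
  obtain ⟨hδ0, hδ1⟩ := hδ
  obtain ⟨hε0, hε1⟩ := hε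
  obtain ⟨k, rfl⟩ := Nat.exists_eq_add_of_le' hT
  set L := Real.log (1 / δ) with hLdef
  have hL : 0 < L := by linarith
  have hexp : Real.exp (-L) = δ := by
    rw [hLdef, one_div, Real.log_inv, neg_neg, Real.exp_log hδ0]
  have ha : 0 < 1 - γ * lam := by linarith
  set M := C0 * (1 - γ * lam) ^ (k + 1) + C1 / lam with hM
  have hM0 : 0 < M := by positivity
  have hv : 0 < σ2 := by rw [hσ2]; positivity
  have hψ : Measurable fun x : E d => x - γ • (clip C1 (G x) + lam • x) :=
    measurable_id.sub
      ((((measurable_clip C1).comp hG).add (measurable_id.const_smul lam)).const_smul γ)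
  have hD : ∀ (t : ℕ) (x x' : E d), ‖x - x'‖ ≤ 2 * (C0 * (1 - γ * lam) ^ t + C1 / lam) →
      ‖(x - γ • (clip C1 (G x) + lam • x)) - (x' - γ • (clip C1 (G x') + lam • x'))‖ ≤
        2 * (C0 * (1 - γ * lam) ^ (t + 1) + C1 / lam) := fun t x x' hx => by
    have hsplit : (x - γ • (clip C1 (G x) + lam • x)) - (x' - γ • (clip C1 (G x') + lam • x')) =
        (1 - γ * lam) • (x - x') + γ • (clip C1 (G x') - clip C1 (G x)) := by module
    have h1 := norm_clip_le hC1.le (G x)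
    have h2 := norm_clip_le hC1.le (G x')
    calc _ ≤ (1 - γ * lam) * ‖x - x'‖ + γ * (‖clip C1 (G x')‖ + ‖clip C1 (G x)‖) := by
          rw [hsplit]
          refine (norm_add_le _ _).trans ?_
          rw [norm_smul, norm_smul, Real.norm_of_nonneg ha.le, Real.norm_of_nonneg hγ.le]
          gcongr
          exact norm_sub_le _ _
      _ ≤ (1 - γ * lam) * (2 * (C0 * (1 - γ * lam) ^ t + C1 / lam)) + γ * (C1 + C1) := by gcongr
      _ = _ := by field_simp; ring
  have hbudget : ((3 * L / ε) ^ 2 + 3 * L / ε) * (2 * M) ^ 2 / (2 * σ2) - 3 * L / ε * ε ≤ -L := by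
    have h1 : ((3 * L / ε) ^ 2 + 3 * L / ε) * (2 * M) ^ 2 / (2 * σ2) =
        (3 * L + ε) / (12 * (γ * lam)) := by
      rw [hσ2]; field_simp; ring
    have h2 : (3 * L + ε) / (12 * (γ * lam)) ≤ L := by
      rw [div_le_iff₀ (by positivity)]
      nlinarith
    rw [h1, div_mul_cancel₀ _ hε0.ne']
    linarith
  have hmain : ∀ y y' : E d, ‖y‖ ≤ C0 → ‖y'‖ ≤ C0 → hockeyStick ε
      (lawSeq (fun _ x => x - γ • (clip C1 (G x) + lam • x)) (fun _ => σ2)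
        (Measure.dirac y) (k + 1))
      (lawSeq (fun _ x => x - γ • (clip C1 (G x) + lam • x)) (fun _ => σ2)
        (Measure.dirac y') (k + 1)) ≤ δ := fun y y' hy hy' => by
    rw [← hexp]
    refine hockeyStick_lawSeq_le (D := fun t => 2 * (C0 * (1 - γ * lam) ^ t + C1 / lam))
      (fun _ => hψ) (fun _ => hv) hD ?_ (s := 3 * L / ε) (by positivity) k hbudget
    have : 0 < C1 / lam := by positivity
    simp only [pow_zero, mul_one]
    linarith [norm_sub_le y y']
  exact ⟨hmain _ _ hx0 hx0', hmain _ _ hx0' hx0⟩
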